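/- Let f, f': C → D be chain maps of finite-dimensional A-module chain complexes. If f and f' are chain homotopic, then for every n the induced maps on the Q-groups coincide: f^% = f'^%: Q^n(C) → Q^n(D), f_% = f'_%: Q_n(C) → Q_n(D), and f̂^% = f̂'^%: Q̂^n(C) → Q̂^n(D). Moreover, if f is a chain homotopy equivalence then f^%, f_% and f̂^% are isomorphisms for every n. -/

import Mathlib

noncomputable section
open scoped Classical

/-- The sign `(-1)^k` for `k : ℤ`. -/
def esign (k : ℤ) : ℤ := (((-1 : ℤˣ) ^ k : ℤˣ) : ℤ)

variable {A : Type} [Ring A] [StarRing A]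

/-- The dual of a left `A`-module, made into a left `A`-module using the involution:
`(a • f) x = f x * star a`. -/
abbrev SDual (A : Type) [Ring A] [StarRing A] (M : Type) [AddCommGroup M] [Module A M] : Type :=
  M →ₗ[A] A

section SDualBasics

variable {M N : Type} [AddCommGroup M] [Module A M] [AddCommGroup N] [Module A N]

instance SDual.instSMul : SMul A (SDual A M) where
  smul a f :=
    { toFun := fun x => f x * star a
      map_add' := fun x y => by simp [add_mul]
      map_smul' := fun c x => by simp [mul_assoc] }

@[simp] theorem SDual.smul_apply (a : A) (f : SDual A M) (x : M) :
    (a • f) x = f x * star a := rfl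

instance SDual.instModule : Module A (SDual A M) :=
  Module.ofMinimalAxioms
    (fun a f g => by ext x; simp [add_mul])
    (fun a b f => by ext x; simp [star_add, mul_add])
    (fun a b f => by ext x; simp [star_mul, mul_assoc])
    (fun f => by ext x; simp)

/-- The dual of an `A`-linear map. -/
def sdualMap (f : M →ₗ[A] N) : SDual A N →ₗ[A] SDual A M where
  toFun g := g.comp f
  map_add' g h := rfl
  map_smul' a g := rfl

@[simp] theorem sdualMap_apply (f : M →ₗ[A] N) (g : SDual A N) (x : M) :
    sdualMap f g x = g (f x) := rfl

/-- The canonical evaluation map `M → M**`, `x ↦ (f ↦ star (f x))`. -/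
def sdualEval (A : Type) [Ring A] [StarRing A] (M : Type) [AddCommGroup M] [Module A M] :
    M →ₗ[A] SDual A (SDual A M) where
  toFun x :=
    { toFun := fun f => star (f x)
      map_add' := fun f g => by simp [star_add]
      map_smul' := fun a f => by simp [star_mul] }
  map_add' x y := by ext f; simp [star_add]
  map_smul' a x := by ext f; simp [star_mul]

end SDualBasics

/-- The underlying graded modules of a chain complex. -/
structure PreCx (A : Type) [Ring A] [StarRing A] : Type 1 where
  Mod : ℤ → Type
  acg : ∀ r, AddCommGroup (Mod r)
  mod : ∀ r, letI := acg r; Module A (Mod r)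

attribute [instance] PreCx.acg PreCx.mod

/-- A finite-dimensional chain complex of f.g. projective left `A`-modules,
together with (the automatically satisfied) reflexivity of the double duality map. -/
structure ChainCx (A : Type) [Ring A] [StarRing A] extends PreCx A : Type 1 where
  fg : ∀ r, Module.Finite A (Mod r)
  proj : ∀ r, Module.Projective A (Mod r)
  bdd : ∃ N : ℕ, ∀ r : ℤ, (N : ℤ) < |r| → Subsingleton (Mod r)
  d : ∀ r, Mod (r + 1) →ₗ[A] Mod r
  dd : ∀ r, (d r).comp (d (r + 1)) = 0
  refl : ∀ r, Function.Bijective (sdualEval A (Mod r))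

namespace ChainCx

variable (C : ChainCx A)

/-- Transport along an equality of degrees. -/
def cst : ∀ {r r' : ℤ}, r = r' → (C.Mod r →ₗ[A] C.Mod r')
  | _, _, rfl => LinearMap.id

/-- Transport of duals along an equality of degrees. -/
def dcst {r r' : ℤ} (h : r = r') : SDual A (C.Mod r) →ₗ[A] SDual A (C.Mod r') :=
  sdualMap (C.cst h.symm)

/-- The inverse of the double duality map. -/
def coev (r : ℤ) : SDual A (SDual A (C.Mod r)) →ₗ[A] C.Mod r :=
  (LinearEquiv.ofBijective (sdualEval A (C.Mod r)) (C.refl r)).symm.toLinearMap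

/-- The transposition `T` on maps `C^p → C_q`, using the identification `M** = M`. -/
def T (p q : ℤ) (θ : SDual A (C.Mod p) →ₗ[A] C.Mod q) :
    SDual A (C.Mod q) →ₗ[A] C.Mod p :=
  esign (p * q) • ((C.coev p).comp (sdualMap θ))

/-- The transposition `T` on maps `C_p → C^q`, using the identification `M** = M`. -/
def Tb (p q : ℤ) (θ : C.Mod p →ₗ[A] SDual A (C.Mod q)) :
    C.Mod q →ₗ[A] SDual A (C.Mod p) :=
  esign (p * q) • ((sdualMap θ).comp (sdualEval A (C.Mod q)))

/-- The dual differential `C^a → C^b` (where `b = a + 1`). -/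
def dstarTo {a b : ℤ} (h : b = a + 1) : SDual A (C.Mod a) →ₗ[A] SDual A (C.Mod b) :=
  sdualMap ((C.d a).comp (C.cst h))

end ChainCx

/-- The group of `n`-dimensional symmetric chains `{φ_s : C^{n-r+s} → C_r}`. -/
abbrev SymCh (C : ChainCx A) (n : ℤ) : Type :=
  ∀ (s : ℕ) (r : ℤ), SDual A (C.Mod (n - r + (s : ℤ))) →ₗ[A] C.Mod r

/-- The group of `n`-dimensional quadratic chains `{ψ_s : C^{n-r-s} → C_r}`. -/
abbrev QuadCh (C : ChainCx A) (n : ℤ) : Type :=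
  ∀ (s : ℕ) (r : ℤ), SDual A (C.Mod (n - r - (s : ℤ))) →ₗ[A] C.Mod r

/-- The group of `n`-dimensional hyperquadratic chains `{θ_s : C^{n-r+s} → C_r}, s ∈ ℤ`. -/
abbrev HypCh (C : ChainCx A) (n : ℤ) : Type :=
  ∀ (s : ℤ) (r : ℤ), SDual A (C.Mod (n - r + s)) →ₗ[A] C.Mod r

variable (C : ChainCx A)

/-- Reindexing of symmetric chains along an equality of dimensions. -/
def symCastDim {n n' : ℤ} (h : n = n') (φ : SymCh C n) : SymCh C n' := fun s r =>
  (φ s r).comp (C.dcst (show n' - r + (s : ℤ) = n - r + (s : ℤ) by rw [h]))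

/-- Reindexing of quadratic chains along an equality of dimensions. -/
def quadCastDim {n n' : ℤ} (h : n = n') (ψ : QuadCh C n) : QuadCh C n' := fun s r =>
  (ψ s r).comp (C.dcst (show n' - r - (s : ℤ) = n - r - (s : ℤ) by rw [h]))

/-- Reindexing of hyperquadratic chains along an equality of dimensions. -/
def hypCastDim {n n' : ℤ} (h : n = n') (θ : HypCh C n) : HypCh C n' := fun s r =>
  (θ s r).comp (C.dcst (show n' - r + s = n - r + s by rw [h]))

/-- The boundary of an `(n+1)`-dimensional symmetric chain:
`(dξ)_s = d ξ_s + (-1)^r ξ_s d* + (-1)^{n+s} (ξ_{s-1} + (-1)^s T ξ_{s-1})`. -/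
def symBnd (n : ℤ) (ξ : SymCh C (n + 1)) : SymCh C n
  | s, r =>
    (C.d r).comp ((ξ s (r + 1)).comp
        (C.dcst (show n - r + (s : ℤ) = n + 1 - (r + 1) + (s : ℤ) by ring)))
    + esign r • ((ξ s r).comp
        (C.dstarTo (show n + 1 - r + (s : ℤ) = (n - r + (s : ℤ)) + 1 by ring)))
    + (match s with
      | 0 => 0
      | (t + 1) =>
        esign (n + 1 + t) • (
          (ξ t r).comp (C.dcst (show n - r + ((t + 1 : ℕ) : ℤ) = n + 1 - r + (t : ℤ) by
            push_cast; ring))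
          + esign ((t : ℤ) + 1) •
            ((C.cst (show n + 1 - (n - r + ((t + 1 : ℕ) : ℤ)) + (t : ℤ) = r by push_cast; ring)).comp
              (C.T _ _ (ξ t (n - r + ((t + 1 : ℕ) : ℤ)))))))

/-- The boundary of an `(n+1)`-dimensional quadratic chain:
`(dχ)_s = d χ_s + (-1)^r χ_s d* + (-1)^{n-s} (χ_{s+1} + (-1)^{s+1} T χ_{s+1})`. -/
def quadBnd (n : ℤ) (χ : QuadCh C (n + 1)) : QuadCh C n := fun s r =>
  (C.d r).comp ((χ s (r + 1)).comp
      (C.dcst (show n - r - (s : ℤ) = n + 1 - (r + 1) - (s : ℤ) by ring)))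
  + esign r • ((χ s r).comp
      (C.dstarTo (show n + 1 - r - (s : ℤ) = (n - r - (s : ℤ)) + 1 by ring)))
  + esign (n - s) • (
      (χ (s + 1) r).comp (C.dcst (show n - r - (s : ℤ) = n + 1 - r - ((s + 1 : ℕ) : ℤ) by
        push_cast; ring))
      + esign ((s : ℤ) + 1) •
        ((C.cst (show n + 1 - (n - r - (s : ℤ)) - ((s + 1 : ℕ) : ℤ) = r by push_cast; ring)).comp
          (C.T _ _ (χ (s + 1) (n - r - (s : ℤ))))))

/-- The boundary of an `(n+1)`-dimensional hyperquadratic chain. -/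
def hypBnd (n : ℤ) (ν : HypCh C (n + 1)) : HypCh C n := fun s r =>
  (C.d r).comp ((ν s (r + 1)).comp
      (C.dcst (show n - r + s = n + 1 - (r + 1) + s by ring)))
  + esign r • ((ν s r).comp
      (C.dstarTo (show n + 1 - r + s = (n - r + s) + 1 by ring)))
  + esign (n + s) • (
      (ν (s - 1) r).comp (C.dcst (show n - r + s = n + 1 - r + (s - 1) by ring))
      + esign s •
        ((C.cst (show n + 1 - (n - r + s) + (s - 1) = r by ring)).comp
          (C.T _ _ (ν (s - 1) (n - r + s)))))

/-- `φ` is an `n`-dimensional symmetric structure on `C`. -/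
def IsSymStr (n : ℤ) (φ : SymCh C n) : Prop :=
  symBnd C (n - 1) (symCastDim C (show n = (n - 1) + 1 by ring) φ) = 0

/-- `ψ` is an `n`-dimensional quadratic structure on `C`. -/
def IsQuadStr (n : ℤ) (ψ : QuadCh C n) : Prop :=
  quadBnd C (n - 1) (quadCastDim C (show n = (n - 1) + 1 by ring) ψ) = 0

/-- `θ` is an `n`-dimensional hyperquadratic structure on `C`. -/
def IsHypStr (n : ℤ) (θ : HypCh C n) : Prop :=
  hypBnd C (n - 1) (hypCastDim C (show n = (n - 1) + 1 by ring) θ) = 0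

/-- The subgroup of `n`-dimensional symmetric structures (cycles). -/
def symCycles (n : ℤ) : AddSubgroup (SymCh C n) := AddSubgroup.closure {φ | IsSymStr C n φ}

/-- The subgroup of boundaries of symmetric chains. -/
def symBdrys (n : ℤ) : AddSubgroup (SymCh C n) := AddSubgroup.closure (Set.range (symBnd C n))

/-- The symmetric `Q`-group `Q^n(C)`. -/
def Qsym (n : ℤ) : Type := symCycles C n ⧸ ((symBdrys C n).addSubgroupOf (symCycles C n))

instance (n : ℤ) : AddCommGroup (Qsym C n) :=
  inferInstanceAs (AddCommGroup (_ ⧸ (_ : AddSubgroup _)))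

/-- The class of a symmetric structure in `Q^n(C)`. -/
def mkSym (n : ℤ) (φ : SymCh C n) (h : IsSymStr C n φ) : Qsym C n :=
  QuotientAddGroup.mk ⟨φ, AddSubgroup.subset_closure h⟩

def quadCycles (n : ℤ) : AddSubgroup (QuadCh C n) := AddSubgroup.closure {ψ | IsQuadStr C n ψ}

def quadBdrys (n : ℤ) : AddSubgroup (QuadCh C n) := AddSubgroup.closure (Set.range (quadBnd C n))

/-- The quadratic `Q`-group `Q_n(C)`. -/
def Qquad (n : ℤ) : Type := quadCycles C n ⧸ ((quadBdrys C n).addSubgroupOf (quadCycles C n))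

instance (n : ℤ) : AddCommGroup (Qquad C n) :=
  inferInstanceAs (AddCommGroup (_ ⧸ (_ : AddSubgroup _)))

def mkQuad (n : ℤ) (ψ : QuadCh C n) (h : IsQuadStr C n ψ) : Qquad C n :=
  QuotientAddGroup.mk ⟨ψ, AddSubgroup.subset_closure h⟩

def hypCycles (n : ℤ) : AddSubgroup (HypCh C n) := AddSubgroup.closure {θ | IsHypStr C n θ}

def hypBdrys (n : ℤ) : AddSubgroup (HypCh C n) := AddSubgroup.closure (Set.range (hypBnd C n))

/-- The hyperquadratic `Q`-group `Q̂^n(C)`. -/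
def Qhyp (n : ℤ) : Type := hypCycles C n ⧸ ((hypBdrys C n).addSubgroupOf (hypCycles C n))

instance (n : ℤ) : AddCommGroup (Qhyp C n) :=
  inferInstanceAs (AddCommGroup (_ ⧸ (_ : AddSubgroup _)))

def mkHyp (n : ℤ) (θ : HypCh C n) (h : IsHypStr C n θ) : Qhyp C n :=
  QuotientAddGroup.mk ⟨θ, AddSubgroup.subset_closure h⟩

/-- The symmetrization `(1+T)ψ` of a quadratic chain. -/
def oneTchain (n : ℤ) (ψ : QuadCh C n) : SymCh C n
  | 0, r =>
    (ψ 0 r).comp (C.dcst (show n - r + ((0 : ℕ) : ℤ) = n - r - ((0 : ℕ) : ℤ) by push_cast; ring))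
    + (C.cst (show n - (n - r + ((0 : ℕ) : ℤ)) - ((0 : ℕ) : ℤ) = r by push_cast; ring)).comp
        (C.T _ _ (ψ 0 (n - r + ((0 : ℕ) : ℤ))))
  | (_ + 1), _ => 0

/-- The map `J` from symmetric to hyperquadratic chains. -/
def Jchain (n : ℤ) (φ : SymCh C n) : HypCh C n := fun s r =>
  if h : 0 ≤ s then
    (φ s.toNat r).comp (C.dcst (by rw [Int.toNat_of_nonneg h]))
  else 0

/-- The map `H` from hyperquadratic to quadratic chains, `ψ_s = θ_{-s-1}`. -/
def Hchain (n : ℤ) (θ : HypCh C n) : QuadCh C (n - 1) := fun s r =>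
  (θ (-(s : ℤ) - 1) r).comp
    (C.dcst (show n - 1 - r - (s : ℤ) = n - r + (-(s : ℤ) - 1) by ring))

/-- A chain map of chain complexes over `A`. -/
structure ChainMap (C D : ChainCx A) : Type where
  f : ∀ r, C.Mod r →ₗ[A] D.Mod r
  comm : ∀ r, (f r).comp (C.d r) = (D.d r).comp (f (r + 1))

/-- Chain homotopy of chain maps. -/
def ChainHtpy {C D : ChainCx A} (F G : ChainMap C D) : Prop :=
  ∃ g : ∀ r, C.Mod r →ₗ[A] D.Mod (r + 1),
    ∀ r, F.f (r + 1) - G.f (r + 1) = (D.d (r + 1)).comp (g (r + 1)) + (g r).comp (C.d r)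

/-- The identity chain map. -/
def ChainMap.idCM (C : ChainCx A) : ChainMap C C :=
  ⟨fun _ => LinearMap.id, fun r => by simp⟩

/-- Composition of chain maps. -/
def ChainMap.compCM {C D E : ChainCx A} (G : ChainMap D E) (F : ChainMap C D) : ChainMap C E :=
  ⟨fun r => (G.f r).comp (F.f r), fun r => by
    rw [LinearMap.comp_assoc, F.comm, ← LinearMap.comp_assoc, G.comm, LinearMap.comp_assoc]⟩

/-- Sum of chain maps. -/
def ChainMap.addCM {C D : ChainCx A} (F G : ChainMap C D) : ChainMap C D :=
  ⟨fun r => F.f r + G.f r, fun r => by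
    rw [LinearMap.add_comp, LinearMap.comp_add, F.comm, G.comm]⟩

/-- A chain map is a chain homotopy equivalence. -/
def IsChainEquiv {C D : ChainCx A} (F : ChainMap C D) : Prop :=
  ∃ G : ChainMap D C, ChainHtpy (G.compCM F) (ChainMap.idCM C) ∧
    ChainHtpy (F.compCM G) (ChainMap.idCM D)

/-- The induced map on symmetric chains, `φ_s ↦ f φ_s f*`. -/
def fSym {C D : ChainCx A} (F : ChainMap C D) (n : ℤ) (φ : SymCh C n) : SymCh D n := fun s r =>
  (F.f r).comp ((φ s r).comp (sdualMap (F.f (n - r + (s : ℤ)))))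

/-- The induced map on quadratic chains. -/
def fQuad {C D : ChainCx A} (F : ChainMap C D) (n : ℤ) (ψ : QuadCh C n) : QuadCh D n := fun s r =>
  (F.f r).comp ((ψ s r).comp (sdualMap (F.f (n - r - (s : ℤ)))))

/-- The induced map on hyperquadratic chains. -/
def fHyp {C D : ChainCx A} (F : ChainMap C D) (n : ℤ) (θ : HypCh C n) : HypCh D n := fun s r =>
  (F.f r).comp ((θ s r).comp (sdualMap (F.f (n - r + s))))

section Induced

variable {C D : ChainCx A} (F : ChainMap C D) (n : ℤ)

/-- `Q` is the group homomorphism `Q^n(C) → Q^n(D)` induced by the chain map `F`. -/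
def IsInducedSym (Q : Qsym C n →+ Qsym D n) : Prop :=
  ∀ (φ : SymCh C n) (h1 : IsSymStr C n φ) (h2 : IsSymStr D n (fSym F n φ)),
    Q (mkSym C n φ h1) = mkSym D n (fSym F n φ) h2

/-- `Q` is the group homomorphism `Q_n(C) → Q_n(D)` induced by the chain map `F`. -/
def IsInducedQuad (Q : Qquad C n →+ Qquad D n) : Prop :=
  ∀ (ψ : QuadCh C n) (h1 : IsQuadStr C n ψ) (h2 : IsQuadStr D n (fQuad F n ψ)),
    Q (mkQuad C n ψ h1) = mkQuad D n (fQuad F n ψ) h2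

/-- `Q` is the group homomorphism `Q̂^n(C) → Q̂^n(D)` induced by the chain map `F`. -/
def IsInducedHyp (Q : Qhyp C n →+ Qhyp D n) : Prop :=
  ∀ (θ : HypCh C n) (h1 : IsHypStr C n θ) (h2 : IsHypStr D n (fHyp F n θ)),
    Q (mkHyp C n θ h1) = mkHyp D n (fHyp F n θ) h2

end Induced

theorem esign_add (a b : ℤ) : esign (a + b) = esign a * esign b := by
  simp [esign, zpow_add]

theorem esign_sub (a b : ℤ) : esign (a - b) = esign a * esign b := by
  have h : ((-1 : ℤˣ) ^ b)⁻¹ = (-1) ^ b := by rw [← inv_zpow, Int.units_inv_eq_self]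
  simp [esign, zpow_sub, h]

@[simp] theorem esign_one : esign 1 = -1 := by simp [esign]

theorem esign_neg (a : ℤ) : esign (-a) = esign a := by
  simp [esign]

theorem esign_eq (a : ℤ) : esign a = 1 ∨ esign a = -1 := by
  rcases Int.units_eq_one_or ((-1 : ℤˣ) ^ a) with h | h <;> simp [esign, h]

theorem esign_mul_self (a : ℤ) : esign a * esign a = 1 := by
  rcases esign_eq a with h | h <;> simp [h]

section Pairing

variable {C : ChainCx A}

theorem ChainCx.hom_ext {M : Type} [AddCommGroup M] [Module A M] {q : ℤ}
    {θ θ' : M →ₗ[A] C.Mod q}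
    (h : ∀ (a : M) (b : SDual A (C.Mod q)), b (θ a) = b (θ' a)) : θ = θ' := by
  refine LinearMap.ext fun a => (C.refl q).1 (LinearMap.ext fun b => ?_)
  exact congrArg star (h a b)

theorem ChainCx.apply_coev {q : ℤ} (b : SDual A (C.Mod q)) (w : SDual A (SDual A (C.Mod q))) :
    b (C.coev q w) = star (w b) := by
  have h : sdualEval A (C.Mod q) (C.coev q w) = w :=
    (LinearEquiv.ofBijective (sdualEval A (C.Mod q)) (C.refl q)).apply_symm_apply w
  have h' : star (b (C.coev q w)) = w b := LinearMap.congr_fun h b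
  rw [← h', star_star]

theorem ChainCx.apply_T {p q : ℤ} (θ : SDual A (C.Mod p) →ₗ[A] C.Mod q)
    (a : SDual A (C.Mod q)) (b : SDual A (C.Mod p)) :
    b (C.T p q θ a) = esign (p * q) • star (a (θ b)) := by
  have h : C.T p q θ a = esign (p * q) • C.coev p (sdualMap θ a) := rfl
  rw [h, map_zsmul, C.apply_coev]
  rfl

theorem ChainCx.T_zero (p q : ℤ) : C.T p q 0 = 0 :=
  C.hom_ext fun a b => by simp [C.apply_T]

end Pairing

/-- Families of maps `C^p → C_q`, one for each `s p q : ℤ`, without any relation between the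
indices. -/
abbrev BigCh (C : ChainCx A) : Type :=
  ∀ _s p q : ℤ, SDual A (C.Mod p) →ₗ[A] C.Mod q

namespace BigCh

variable {C D : ChainCx A}

/-- The boundary on unrestricted families; `e` is a twist of the transposition. -/
def bnd (e n : ℤ) (X : BigCh C) : BigCh C := fun s p q =>
  (C.d q).comp (X s p (q + 1)) + esign q • (X s (p + 1) q).comp (C.dstarTo rfl)
    + esign (n + s) • (X (s - 1) p q + esign (s + e) • C.T q p (X (s - 1) q p))

/-- The action of a chain map on unrestricted families. -/
def map (F : ChainMap C D) : BigCh C →+ BigCh D where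
  toFun X s p q := (F.f q).comp ((X s p q).comp (sdualMap (F.f p)))
  map_zero' := by ext; simp
  map_add' _ _ := by ext; simp

theorem apply_bnd (e n : ℤ) (X : BigCh C) (s : ℤ) {p q p' q' : ℤ} (hp : p' = p + 1)
    (hq : q' = q + 1) (a : SDual A (C.Mod p)) (b : SDual A (C.Mod q)) :
    b (bnd e n X s p q a) =
      C.dstarTo hq b (X s p q' a) + esign q • b (X s p' q (C.dstarTo hp a))
      + esign (n + s) • (b (X (s - 1) p q a)
        + (esign (s + e) * esign (p * q)) • star (a (X (s - 1) q p b))) := by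
  subst hp hq
  have h : bnd e n X s p q a = C.d q (X s p (q + 1) a)
    + esign q • (X s (p + 1) q (C.dstarTo rfl a))
    + esign (n + s) • (X (s - 1) p q a + esign (s + e) • C.T q p (X (s - 1) q p) a) := rfl
  rw [h, map_add, map_add, map_zsmul, map_zsmul, map_add, map_zsmul, C.apply_T, mul_smul,
    mul_comm q p]
  rfl

theorem apply_map (F : ChainMap C D) (X : BigCh C) (s p q : ℤ)
    (a : SDual A (D.Mod p)) (b : SDual A (D.Mod q)) :
    b (map F X s p q a) = sdualMap (F.f q) b (X s p q (sdualMap (F.f p) a)) := rfl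

end BigCh

theorem ChainMap.dstarTo_sdualMap {C D : ChainCx A} (F : ChainMap C D) {p p' : ℤ} (h : p' = p + 1)
    (a : SDual A (D.Mod p)) :
    C.dstarTo h (sdualMap (F.f p) a) = sdualMap (F.f p') (D.dstarTo h a) := by
  subst h
  exact LinearMap.ext fun x => congrArg a (LinearMap.congr_fun (F.comm p) x)

namespace BigCh

variable {C D : ChainCx A}

theorem map_bnd (F : ChainMap C D) (e n : ℤ) (X : BigCh C) :
    map F (bnd e n X) = bnd e n (map F X) := by
  funext s p q
  refine D.hom_ext fun a b => ?_
  simp only [apply_map, apply_bnd e n _ s (rfl : p + 1 = p + 1) (rfl : q + 1 = q + 1),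
    F.dstarTo_sdualMap]

section Homotopy

variable (F F' : ChainMap C D) (g : ∀ r, C.Mod r →ₗ[A] D.Mod (r + 1))

/-- The degree one map `C_p → D_{p'}` of a homotopy, where `p' = p + 1`. -/
def gTo {p p' : ℤ} (h : p' = p + 1) : C.Mod p →ₗ[A] D.Mod p' := (D.cst h.symm).comp (g p)

theorem sdualMap_homotopy
    (hg : ∀ r, F.f (r + 1) - F'.f (r + 1) = (D.d (r + 1)).comp (g (r + 1)) + (g r).comp (C.d r))
    {p₀ p p₁ : ℤ} (h₀ : p = p₀ + 1) (h₁ : p₁ = p + 1) (a : SDual A (D.Mod p)) :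
    sdualMap (F.f p) a = sdualMap (F'.f p) a + sdualMap (gTo g h₁) (D.dstarTo h₁ a)
      + C.dstarTo h₀ (sdualMap (gTo g h₀) a) := by
  subst h₀ h₁
  refine LinearMap.ext fun x => ?_
  have h := congrArg a (LinearMap.congr_fun (hg p₀) x)
  have h' : a (F.f (p₀ + 1) x) - a (F'.f (p₀ + 1) x) =
      a (D.d (p₀ + 1) (g (p₀ + 1) x)) + a (g p₀ (C.d p₀ x)) := by
    rw [← map_sub, ← map_add]; exact h
  rw [sub_eq_iff_eq_add'] at h'
  exact h'.trans (add_assoc _ _ _).symm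

/-- The homotopy between the actions of two homotopic chain maps. -/
def htpy (e n : ℤ) (X : BigCh C) : BigCh D := fun s p q =>
  (gTo g (sub_add_cancel q 1).symm).comp ((X s p (q - 1)).comp (sdualMap (F.f p)))
  + esign q • (F'.f q).comp
      ((X s (p - 1) q).comp (sdualMap (gTo g (sub_add_cancel p 1).symm)))
  + (esign (n + e) * esign q) • (gTo g (sub_add_cancel q 1).symm).comp
      ((C.T (q - 1) (p - 1) (X (s - 1) (q - 1) (p - 1))).comp
        (sdualMap (gTo g (sub_add_cancel p 1).symm)))

theorem apply_htpy (e n : ℤ) (X : BigCh C) (s : ℤ) {p q p₀ q₀ : ℤ} (hp : p = p₀ + 1)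
    (hq : q = q₀ + 1) (a : SDual A (D.Mod p)) (b : SDual A (D.Mod q)) :
    b (htpy F F' g e n X s p q a) =
      sdualMap (gTo g hq) b (X s p q₀ (sdualMap (F.f p) a))
      + esign q • sdualMap (F'.f q) b (X s p₀ q (sdualMap (gTo g hp) a))
      + (esign (n + e) * esign q * esign (p₀ * q₀)) •
        star (sdualMap (gTo g hp) a (X (s - 1) q₀ p₀ (sdualMap (gTo g hq) b))) := by
  obtain rfl : p₀ = p - 1 := by omega
  obtain rfl : q₀ = q - 1 := by omega
  rw [mul_smul _ (esign ((p - 1) * (q - 1))), mul_comm (p - 1), ← C.apply_T]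
  simp only [htpy, LinearMap.add_apply, map_add, LinearMap.smul_apply, map_zsmul]
  rfl

theorem map_sub_map_eq
    (hg : ∀ r, F.f (r + 1) - F'.f (r + 1) = (D.d (r + 1)).comp (g (r + 1)) + (g r).comp (C.d r))
    (e n : ℤ) (X : BigCh C) :
    map F X - map F' X =
      bnd e n (htpy F F' g e n X) + htpy F F' g e (n - 1) (bnd e (n - 1) X) := by
  funext s p q
  refine D.hom_ext fun a b => ?_
  obtain ⟨p₀, hp₀⟩ : ∃ p₀, p = p₀ + 1 := ⟨p - 1, by ring⟩
  obtain ⟨q₀, hq₀⟩ : ∃ q₀, q = q₀ + 1 := ⟨q - 1, by ring⟩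
  obtain ⟨p₁, hp₁⟩ : ∃ p₁, p₁ = p + 1 := ⟨_, rfl⟩
  obtain ⟨q₁, hq₁⟩ : ∃ q₁, q₁ = q + 1 := ⟨_, rfl⟩
  have hl : b ((map F X - map F' X) s p q a) = b (map F X s p q a) - b (map F' X s p q a) :=
    map_sub b _ _
  have hr : b ((bnd e n (htpy F F' g e n X) + htpy F F' g e (n - 1) (bnd e (n - 1) X)) s p q a) =
      b (bnd e n (htpy F F' g e n X) s p q a)
        + b (htpy F F' g e (n - 1) (bnd e (n - 1) X) s p q a) :=
    map_add b _ _
  rw [hl, hr, apply_map, apply_map, apply_bnd e n _ s hp₁ hq₁,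
    apply_htpy F F' g e n X s hp₀ hq₁, apply_htpy F F' g e n X s hp₁ hq₀,
    apply_htpy F F' g e n X (s - 1) hp₀ hq₀, apply_htpy F F' g e n X (s - 1) hq₀ hp₀,
    apply_htpy F F' g e (n - 1) _ s hp₀ hq₀,
    apply_bnd e (n - 1) X s hp₁ hq₀, apply_bnd e (n - 1) X s hp₀ hq₁,
    apply_bnd e (n - 1) X (s - 1) hq₀ hp₀]
  simp only [← F.dstarTo_sdualMap, ← F'.dstarTo_sdualMap]
  generalize C.dstarTo hp₁ (sdualMap (F.f p) a) = u
  generalize C.dstarTo hq₁ (sdualMap (F'.f q) b) = v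
  rw [sdualMap_homotopy F F' g hg hp₀ hp₁ a, sdualMap_homotopy F F' g hg hq₀ hq₁ b]
  have esign_succ_mul : ∀ x y : ℤ, esign ((x + 1) * y) = esign (x * y) * esign y := fun x y => by
    rw [add_mul, one_mul, esign_add]
  have esign_mul_succ : ∀ x y : ℤ, esign (x * (y + 1)) = esign (x * y) * esign x := fun x y => by
    rw [mul_add, mul_one, esign_add]
  have hpq : esign (q₀ * p₀) = esign (p₀ * q₀) := by rw [mul_comm]
  have hz : ∀ (k : ℤ) (x : A), star (k • x) = k • star x := fun k x => star_zsmul k x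
  subst hp₀ hq₀ hp₁ hq₁
  simp only [map_add, LinearMap.add_apply, star_add, star_star, hz, smul_add, smul_smul, esign_add,
    esign_sub, esign_one, esign_succ_mul, esign_mul_succ, hpq]
  have h₁ := esign_mul_self n
  have h₂ := esign_mul_self s
  have h₃ := esign_mul_self p₀
  have h₄ := esign_mul_self q₀
  have h₅ := esign_mul_self e
  have h₆ := esign_mul_self (p₀ * q₀)
  clear hg hl hr hz esign_succ_mul esign_mul_succ hpq
  match_scalars <;> grind

end Homotopy

/-- The family vanishes in the rows satisfying `P`. -/
def VanishOn (P : ℤ → Prop) (X : BigCh C) : Prop := ∀ s, P s → ∀ p q, X s p q = 0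

variable {P : ℤ → Prop} {X : BigCh C}

theorem VanishOn.map (hX : X.VanishOn P) (F : ChainMap C D) : (map F X).VanishOn P :=
  fun s hs p q => by simp [BigCh.map, hX s hs p q]

theorem VanishOn.bnd (hP : ∀ s, P s → P (s - 1)) (hX : X.VanishOn P) (e n : ℤ) :
    (bnd e n X).VanishOn P :=
  fun s hs p q => by
    simp [BigCh.bnd, hX s hs, hX (s - 1) (hP s hs), ChainCx.T_zero]

theorem VanishOn.htpy (hP : ∀ s, P s → P (s - 1)) (hX : X.VanishOn P) (F F' : ChainMap C D)
    (g : ∀ r, C.Mod r →ₗ[A] D.Mod (r + 1)) (e n : ℤ) : (htpy F F' g e n X).VanishOn P :=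
  fun s hs p q => by
    simp [BigCh.htpy, hX s hs, hX (s - 1) (hP s hs), ChainCx.T_zero]

end BigCh

/-- A theory of `Q`-groups whose chains are the restrictions of unrestricted families vanishing in
the rows `low` to the positions `C^p → C_q` with `p + q = n + s` in the rows `region`. -/
structure QTheory (A : Type) [Ring A] [StarRing A] where
  Ch : ChainCx A → ℤ → Type
  acg : ∀ C n, AddCommGroup (Ch C n)
  twist : ℤ
  low : ℤ → Prop
  region : ℤ → Prop
  low_pred : ∀ s, low s → low (s - 1)
  region_pred : ∀ s, region s → low (s - 1) ∨ region (s - 1)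
  res : ∀ C n, BigCh C →+ Ch C n
  exists_res_eq : ∀ C n (φ : Ch C n), ∃ X : BigCh C, X.VanishOn low ∧ res C n X = φ
  res_eq_zero : ∀ C n (X : BigCh C),
    res C n X = 0 ↔ ∀ s p q, region s → p + q = n + s → X s p q = 0
  bnd : ∀ C n, Ch C (n + 1) → Ch C n
  bnd_res : ∀ C n (X : BigCh C), X.VanishOn low →
    bnd C n (res C (n + 1) X) = res C n (BigCh.bnd twist n X)
  IsCycle : ∀ C n, Ch C n → Prop
  isCycle_res : ∀ C n (X : BigCh C), X.VanishOn low →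
    (IsCycle C n (res C n X) ↔ res C (n - 1) (BigCh.bnd twist (n - 1) X) = 0)
  map : ∀ {C D : ChainCx A}, ChainMap C D → ∀ n, Ch C n → Ch D n
  map_res : ∀ {C D : ChainCx A} (F : ChainMap C D) n (X : BigCh C),
    map F n (res C n X) = res D n (BigCh.map F X)

namespace QTheory

variable (T : QTheory A) {C D E : ChainCx A}

instance (C : ChainCx A) (n : ℤ) : AddCommGroup (T.Ch C n) := T.acg C n

/-- The action of a chain map on chains as a homomorphism. -/
def mapHom (F : ChainMap C D) (n : ℤ) : T.Ch C n →+ T.Ch D n :=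
  AddMonoidHom.mk' (T.map F n) fun φ φ' => by
    obtain ⟨X, -, rfl⟩ := T.exists_res_eq C n φ
    obtain ⟨Y, -, rfl⟩ := T.exists_res_eq C n φ'
    rw [← map_add, T.map_res, T.map_res, T.map_res, map_add, map_add]

theorem mapHom_res (F : ChainMap C D) (n : ℤ) (X : BigCh C) :
    T.mapHom F n (T.res C n X) = T.res D n (BigCh.map F X) :=
  T.map_res F n X

theorem mapHom_id (n : ℤ) (φ : T.Ch C n) : T.mapHom (ChainMap.idCM C) n φ = φ := by
  obtain ⟨X, -, rfl⟩ := T.exists_res_eq C n φ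
  exact T.mapHom_res _ n X

theorem mapHom_comp (G : ChainMap D E) (F : ChainMap C D) (n : ℤ) (φ : T.Ch C n) :
    T.mapHom (G.compCM F) n φ = T.mapHom G n (T.mapHom F n φ) := by
  obtain ⟨X, -, rfl⟩ := T.exists_res_eq C n φ
  rw [T.mapHom_res, T.mapHom_res, T.mapHom_res]
  rfl

theorem mapHom_bnd (F : ChainMap C D) (n : ℤ) (ξ : T.Ch C (n + 1)) :
    T.mapHom F n (T.bnd C n ξ) = T.bnd D n (T.mapHom F (n + 1) ξ) := by
  obtain ⟨X, hX, rfl⟩ := T.exists_res_eq C (n + 1) ξ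
  rw [T.bnd_res C n X hX, T.mapHom_res, T.mapHom_res, T.bnd_res D n _ (hX.map F), BigCh.map_bnd]

variable {T} in
theorem IsCycle.map {n : ℤ} {φ : T.Ch C n} (h : T.IsCycle C n φ) (F : ChainMap C D) :
    T.IsCycle D n (T.mapHom F n φ) := by
  obtain ⟨X, hX, rfl⟩ := T.exists_res_eq C n φ
  rw [T.isCycle_res C n X hX] at h
  rw [T.mapHom_res, T.isCycle_res D n _ (hX.map F), ← BigCh.map_bnd, ← T.mapHom_res, h, map_zero]

theorem exists_bnd_eq_sub {F F' : ChainMap C D} (hF : ChainHtpy F F') {n : ℤ} {φ : T.Ch C n}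
    (h : T.IsCycle C n φ) :
    ∃ ξ, T.bnd D n ξ = T.mapHom F n φ - T.mapHom F' n φ := by
  obtain ⟨g, hg⟩ := hF
  obtain ⟨X, hX, rfl⟩ := T.exists_res_eq C n φ
  rw [T.isCycle_res C n X hX, T.res_eq_zero] at h
  have hB := hX.bnd T.low_pred T.twist (n - 1)
  refine ⟨T.res D (n + 1) (BigCh.htpy F F' g T.twist n X), ?_⟩
  have h₀ : T.res D n
      (BigCh.htpy F F' g T.twist (n - 1) (BigCh.bnd T.twist (n - 1) X)) = 0 := by
    rw [T.res_eq_zero]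
    intro s p q hs hpq
    have h₁ := h s p (q - 1) hs (by omega)
    have h₂ := h s (p - 1) q hs (by omega)
    have h₃ : BigCh.bnd T.twist (n - 1) X (s - 1) (q - 1) (p - 1) = 0 :=
      (T.region_pred s hs).elim (fun hl => hB _ hl _ _) fun hr => h _ _ _ hr (by omega)
    simp [BigCh.htpy, h₁, h₂, h₃, ChainCx.T_zero]
  rw [T.bnd_res D n _ (hX.htpy T.low_pred F F' g _ n), T.mapHom_res, T.mapHom_res, ← map_sub,
    BigCh.map_sub_map_eq F F' g hg T.twist n X, map_add, h₀, add_zero]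

/-- The group of cycles. -/
def cycles (C : ChainCx A) (n : ℤ) : AddSubgroup (T.Ch C n) :=
  AddSubgroup.closure {φ | T.IsCycle C n φ}

/-- The group of boundaries. -/
def bdrys (C : ChainCx A) (n : ℤ) : AddSubgroup (T.Ch C n) :=
  AddSubgroup.closure (Set.range (T.bnd C n))

/-- The `Q`-group of a theory. -/
abbrev Q (C : ChainCx A) (n : ℤ) : Type :=
  T.cycles C n ⧸ (T.bdrys C n).addSubgroupOf (T.cycles C n)

/-- The class of a cycle. -/
def cls {n : ℤ} (φ : T.Ch C n) (h : T.IsCycle C n φ) : T.Q C n :=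
  QuotientAddGroup.mk ⟨φ, AddSubgroup.subset_closure h⟩

/-- `Φ` is induced by the chain map `F`. -/
def IsInduced (F : ChainMap C D) (n : ℤ) (Φ : T.Q C n →+ T.Q D n) : Prop :=
  ∀ (φ : T.Ch C n) (h₁ : T.IsCycle C n φ) (h₂ : T.IsCycle D n (T.map F n φ)),
    Φ (T.cls φ h₁) = T.cls (T.map F n φ) h₂

theorem exists_isInduced (F : ChainMap C D) (n : ℤ) : ∃ Φ, T.IsInduced F n Φ := by
  have hZ : T.cycles C n ≤ (T.cycles D n).comap (T.mapHom F n) :=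
    (AddSubgroup.closure_le _).2 fun φ hφ => AddSubgroup.subset_closure (hφ.map F)
  have hB : T.bdrys C n ≤ (T.bdrys D n).comap (T.mapHom F n) := by
    refine (AddSubgroup.closure_le _).2 ?_
    rintro _ ⟨ξ, rfl⟩
    exact AddSubgroup.subset_closure ⟨_, (T.mapHom_bnd F n ξ).symm⟩
  let Z : T.cycles C n →+ T.cycles D n :=
    ((T.mapHom F n).comp (T.cycles C n).subtype).codRestrict (T.cycles D n) fun φ => hZ φ.2
  exact ⟨QuotientAddGroup.map _ _ Z fun φ hφ => hB hφ, fun φ h₁ h₂ => rfl⟩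

theorem hom_ext {G : Type} [AddCommGroup G] {n : ℤ} {Φ Φ' : T.Q C n →+ G}
    (h : ∀ φ (hφ : T.IsCycle C n φ), Φ (T.cls φ hφ) = Φ' (T.cls φ hφ)) : Φ = Φ' := by
  refine QuotientAddGroup.addMonoidHom_ext _ (AddMonoidHom.ext ?_)
  rintro ⟨φ, hφ⟩
  induction hφ using AddSubgroup.closure_induction with
  | mem φ hφ => exact h φ hφ
  | zero => exact (map_zero _).trans (map_zero _).symm
  | add x y hx hy h₁ h₂ =>
    have := congrArg₂ (· + ·) h₁ h₂
    simp only [← map_add] at this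
    exact this
  | neg x hx h₁ =>
    have := congrArg (- ·) h₁
    simp only [← map_neg] at this
    exact this

variable {T} in
theorem IsInduced.apply_cls {F : ChainMap C D} {n : ℤ} {Φ : T.Q C n →+ T.Q D n}
    (hΦ : T.IsInduced F n Φ) (φ : T.Ch C n) (h : T.IsCycle C n φ) :
    Φ (T.cls φ h) = T.cls (T.mapHom F n φ) (h.map F) :=
  hΦ φ h (h.map F)

theorem cls_eq_of_chainHtpy {F F' : ChainMap C D} (hF : ChainHtpy F F') {n : ℤ} {φ : T.Ch C n}
    (h : T.IsCycle C n φ) :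
    T.cls (T.mapHom F n φ) (h.map F) = T.cls (T.mapHom F' n φ) (h.map F') := by
  refine (QuotientAddGroup.eq_iff_sub_mem).2 ?_
  exact AddSubgroup.subset_closure (T.exists_bnd_eq_sub hF h)

variable {T} in
theorem IsInduced.eq_of_chainHtpy {F F' : ChainMap C D} (hF : ChainHtpy F F') {n : ℤ}
    {Φ Φ' : T.Q C n →+ T.Q D n} (hΦ : T.IsInduced F n Φ) (hΦ' : T.IsInduced F' n Φ') : Φ = Φ' :=
  T.hom_ext fun φ hφ => by
    rw [hΦ.apply_cls, hΦ'.apply_cls, T.cls_eq_of_chainHtpy hF hφ]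

variable {T} in
theorem IsInduced.leftInverse {F : ChainMap C D} {G : ChainMap D C}
    (h : ChainHtpy (G.compCM F) (ChainMap.idCM C)) {n : ℤ}
    {Φ : T.Q C n →+ T.Q D n} {Ψ : T.Q D n →+ T.Q C n} (hΦ : T.IsInduced F n Φ)
    (hΨ : T.IsInduced G n Ψ) : Function.LeftInverse Ψ Φ := by
  have h' : Ψ.comp Φ = AddMonoidHom.id _ := T.hom_ext fun φ hφ => by
    have := T.cls_eq_of_chainHtpy h hφ
    simp only [T.mapHom_id, T.mapHom_comp] at this
    rw [AddMonoidHom.comp_apply, hΦ.apply_cls, hΨ.apply_cls, this, AddMonoidHom.id_apply]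
  exact DFunLike.congr_fun h'

variable {T} in
theorem IsInduced.bijective {F : ChainMap C D} (hF : IsChainEquiv F) {n : ℤ}
    {Φ : T.Q C n →+ T.Q D n} (hΦ : T.IsInduced F n Φ) : Function.Bijective Φ := by
  obtain ⟨G, h₁, h₂⟩ := hF
  obtain ⟨Ψ, hΨ⟩ := T.exists_isInduced G n
  exact ⟨(hΦ.leftInverse h₁ hΨ).injective, (hΨ.leftInverse h₂ hΦ).surjective⟩

end QTheory

namespace BigCh

variable {C : ChainCx A} (X : BigCh C)

theorem comp_dcst (s q : ℤ) {p p' : ℤ} (h : p' = p) :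
    (X s p q).comp (C.dcst h) = X s p' q := by
  subst h; rfl

theorem comp_dcst_of_eq (q : ℤ) {s s' p p' : ℤ} (hs : s = s') (h : p' = p) :
    (X s p q).comp (C.dcst h) = X s' p' q := by
  subst hs h; rfl

theorem comp_dstarTo (s q : ℤ) {p p' : ℤ} (h : p' = p + 1) :
    (X s p' q).comp (C.dstarTo h) = (X s (p + 1) q).comp (C.dstarTo rfl) := by
  subst h; rfl

theorem cst_comp_T (q : ℤ) {s s' p p' : ℤ} (hs : s = s') (h : p = p') :
    (C.cst h).comp (C.T p q (X s p q)) = C.T p' q (X s' p' q) := by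
  subst hs h; rfl

/-- Restriction to symmetric chains. -/
def symRes (C : ChainCx A) (n : ℤ) : BigCh C →+ SymCh C n where
  toFun X s r := X s (n - r + s) r
  map_zero' := rfl
  map_add' _ _ := rfl

/-- Restriction to quadratic chains. -/
def quadRes (C : ChainCx A) (n : ℤ) : BigCh C →+ QuadCh C n where
  toFun X s r := X (-s) (n - r - s) r
  map_zero' := rfl
  map_add' _ _ := rfl

/-- Restriction to hyperquadratic chains. -/
def hypRes (C : ChainCx A) (n : ℤ) : BigCh C →+ HypCh C n where
  toFun X s r := X s (n - r + s) r
  map_zero' := rfl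
  map_add' _ _ := rfl

theorem symBnd_symRes (n : ℤ) {X : BigCh C} (hX : X.VanishOn (· < 0)) :
    symBnd C n (symRes C (n + 1) X) = symRes C n (bnd 0 n X) := by
  funext s r
  have h : symRes C n (bnd 0 n X) s r = bnd 0 n X s (n - r + s) r := rfl
  have h₁ := X.comp_dcst s (r + 1) (show n - r + (s : ℤ) = n + 1 - (r + 1) + s by ring)
  have h₂ := X.comp_dstarTo s r (show n + 1 - r + (s : ℤ) = n - r + s + 1 by ring)
  rw [h, bnd, ← h₁, ← h₂]
  cases s with
  | zero =>
    have h₃ : ∀ p q, X (((0 : ℕ) : ℤ) - 1) p q = 0 := hX _ (by norm_num)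
    rw [h₃, h₃, C.T_zero]
    simp only [symBnd, smul_zero, add_zero]
    rfl
  | succ t =>
    have h₄ := X.comp_dcst_of_eq r (show (t : ℤ) = ((t + 1 : ℕ) : ℤ) - 1 by push_cast; ring)
      (show n - r + ((t + 1 : ℕ) : ℤ) = n + 1 - r + (t : ℤ) by push_cast; ring)
    have h₅ := X.cst_comp_T (n - r + ((t + 1 : ℕ) : ℤ))
      (show (t : ℤ) = ((t + 1 : ℕ) : ℤ) - 1 by push_cast; ring)
      (show n + 1 - (n - r + ((t + 1 : ℕ) : ℤ)) + (t : ℤ) = r by push_cast; ring)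
    rw [← h₄, ← h₅, show n + ((t + 1 : ℕ) : ℤ) = n + 1 + t by push_cast; ring,
      show ((t + 1 : ℕ) : ℤ) + 0 = (t : ℤ) + 1 by push_cast; ring]
    rfl

theorem quadBnd_quadRes (n : ℤ) (X : BigCh C) :
    quadBnd C n (quadRes C (n + 1) X) = quadRes C n (bnd 1 n X) := by
  funext s r
  have h : quadRes C n (bnd 1 n X) s r = bnd 1 n X (-s) (n - r - s) r := rfl
  have h₁ := X.comp_dcst (-s) (r + 1) (show n - r - (s : ℤ) = n + 1 - (r + 1) - s by ring)
  have h₂ := X.comp_dstarTo (-s) r (show n + 1 - r - (s : ℤ) = n - r - s + 1 by ring)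
  have h₄ := X.comp_dcst_of_eq r (show -((s + 1 : ℕ) : ℤ) = -s - 1 by push_cast; ring)
    (show n - r - (s : ℤ) = n + 1 - r - ((s + 1 : ℕ) : ℤ) by push_cast; ring)
  have h₅ := X.cst_comp_T (n - r - s) (show -((s + 1 : ℕ) : ℤ) = -s - 1 by push_cast; ring)
    (show n + 1 - (n - r - (s : ℤ)) - ((s + 1 : ℕ) : ℤ) = r by push_cast; ring)
  rw [h, bnd, ← h₁, ← h₂, ← h₄, ← h₅, ← sub_eq_add_neg, esign_add (-s), esign_neg, ← esign_add]
  rfl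

theorem hypBnd_hypRes (n : ℤ) (X : BigCh C) :
    hypBnd C n (hypRes C (n + 1) X) = hypRes C n (bnd 0 n X) := by
  funext s r
  have h : hypRes C n (bnd 0 n X) s r = bnd 0 n X s (n - r + s) r := rfl
  have h₁ := X.comp_dcst s (r + 1) (show n - r + s = n + 1 - (r + 1) + s by ring)
  have h₂ := X.comp_dstarTo s r (show n + 1 - r + s = n - r + s + 1 by ring)
  have h₄ := X.comp_dcst (s - 1) r (show n - r + s = n + 1 - r + (s - 1) by ring)
  have h₅ := X.cst_comp_T (n - r + s) (rfl : s - 1 = s - 1)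
    (show n + 1 - (n - r + s) + (s - 1) = r by ring)
  have h₆ : esign (s + 0) = esign s := by rw [add_zero]
  rw [h, bnd, ← h₁, ← h₂, ← h₄, ← h₅, h₆]
  rfl

theorem symCastDim_symRes {n n' : ℤ} (h : n = n') :
    symCastDim C h (symRes C n X) = symRes C n' X := by
  subst h; rfl

theorem quadCastDim_quadRes {n n' : ℤ} (h : n = n') :
    quadCastDim C h (quadRes C n X) = quadRes C n' X := by
  subst h; rfl

theorem hypCastDim_hypRes {n n' : ℤ} (h : n = n') :
    hypCastDim C h (hypRes C n X) = hypRes C n' X := by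
  subst h; rfl

theorem exists_symRes_eq (n : ℤ) (φ : SymCh C n) :
    ∃ X : BigCh C, X.VanishOn (· < 0) ∧ symRes C n X = φ := by
  refine ⟨fun s p q => if h : 0 ≤ s ∧ p = n - q + s then
    (φ s.toNat q).comp (C.dcst (by rw [Int.toNat_of_nonneg h.1, h.2])) else 0, ?_, ?_⟩
  · exact fun s hs p q => dif_neg fun h => absurd h.1 (not_le.2 hs)
  · have key : ∀ (s t : ℕ) (r : ℤ) (ht : t = s) (h : n - r + (s : ℤ) = n - r + t),
        (φ t r).comp (C.dcst h) = φ s r := by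
      rintro s _ r rfl h; rfl
    funext s r
    exact (dif_pos ⟨s.cast_nonneg, rfl⟩).trans (key _ _ _ (Int.toNat_natCast s) _)

theorem exists_quadRes_eq (n : ℤ) (ψ : QuadCh C n) : ∃ X : BigCh C, quadRes C n X = ψ := by
  refine ⟨fun s p q => if h : s ≤ 0 ∧ p = n - q + s then
    (ψ (-s).toNat q).comp (C.dcst (by rw [Int.toNat_of_nonneg (by omega), h.2]; ring)) else 0, ?_⟩
  have key : ∀ (s t : ℕ) (r : ℤ) (ht : t = s) (h : n - r - (s : ℤ) = n - r - t),
      (ψ t r).comp (C.dcst h) = ψ s r := by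
    rintro s _ r rfl h; rfl
  funext s r
  exact (dif_pos (show -(s : ℤ) ≤ 0 ∧ n - r - (s : ℤ) = n - r + -s from ⟨by omega, by ring⟩)).trans
    (key _ _ _ (by omega) _)

theorem exists_hypRes_eq (n : ℤ) (θ : HypCh C n) : ∃ X : BigCh C, hypRes C n X = θ := by
  refine ⟨fun s p q => if h : p = n - q + s then (θ s q).comp (C.dcst h) else 0, ?_⟩
  funext s r
  exact dif_pos rfl

theorem symRes_eq_zero (n : ℤ) :
    symRes C n X = 0 ↔ ∀ s p q, 0 ≤ s → p + q = n + s → X s p q = 0 := by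
  refine ⟨fun h s p q hs hpq => ?_, fun h => funext₂ fun s r => h _ _ _ (by omega) (by ring)⟩
  lift s to ℕ using hs
  obtain rfl : p = n - q + s := by omega
  exact congrFun₂ h s q

theorem quadRes_eq_zero (n : ℤ) :
    quadRes C n X = 0 ↔ ∀ s p q, s ≤ 0 → p + q = n + s → X s p q = 0 := by
  refine ⟨fun h s p q hs hpq => ?_, fun h => funext₂ fun s r => h _ _ _ (by omega) (by ring)⟩
  obtain ⟨t, rfl⟩ : ∃ t : ℕ, s = -t := ⟨s.natAbs, by omega⟩
  obtain rfl : p = n - q - t := by omega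
  exact congrFun₂ h t q

theorem hypRes_eq_zero (n : ℤ) :
    hypRes C n X = 0 ↔ ∀ s p q, p + q = n + s → X s p q = 0 := by
  refine ⟨fun h s p q hpq => ?_, fun h => funext₂ fun s r => h _ _ _ (by ring)⟩
  obtain rfl : p = n - q + s := by omega
  exact congrFun₂ h s q

end BigCh

namespace QTheory

/-- Symmetric `Q`-groups. -/
def sym (A : Type) [Ring A] [StarRing A] : QTheory A where
  Ch := SymCh
  acg _ _ := inferInstance
  twist := 0
  low s := s < 0
  region s := 0 ≤ s
  low_pred := by omega
  region_pred := by omega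
  res := BigCh.symRes
  exists_res_eq _ n φ := BigCh.exists_symRes_eq n φ
  res_eq_zero _ n X := X.symRes_eq_zero n
  bnd := symBnd
  bnd_res _ n _ hX := BigCh.symBnd_symRes n hX
  IsCycle := IsSymStr
  isCycle_res C n X hX := by
    rw [IsSymStr, BigCh.symCastDim_symRes, BigCh.symBnd_symRes _ hX]
  map := fSym
  map_res _ _ _ := rfl

/-- Quadratic `Q`-groups. -/
def quad (A : Type) [Ring A] [StarRing A] : QTheory A where
  Ch := QuadCh
  acg _ _ := inferInstance
  twist := 1
  low _ := False
  region s := s ≤ 0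
  low_pred _ := id
  region_pred := by omega
  res := BigCh.quadRes
  exists_res_eq _ n ψ := (BigCh.exists_quadRes_eq n ψ).imp fun _ h => ⟨fun _ => False.elim, h⟩
  res_eq_zero _ n X := X.quadRes_eq_zero n
  bnd := quadBnd
  bnd_res _ n X _ := X.quadBnd_quadRes n
  IsCycle := IsQuadStr
  isCycle_res C n X _ := by
    rw [IsQuadStr, BigCh.quadCastDim_quadRes, BigCh.quadBnd_quadRes]
  map := fQuad
  map_res _ _ _ := rfl

/-- Hyperquadratic `Q`-groups. -/
def hyp (A : Type) [Ring A] [StarRing A] : QTheory A where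
  Ch := HypCh
  acg _ _ := inferInstance
  twist := 0
  low _ := False
  region _ := True
  low_pred _ := id
  region_pred _ _ := Or.inr trivial
  res := BigCh.hypRes
  exists_res_eq _ n θ := (BigCh.exists_hypRes_eq n θ).imp fun _ h => ⟨fun _ => False.elim, h⟩
  res_eq_zero _ n X := by simpa using X.hypRes_eq_zero n
  bnd := hypBnd
  bnd_res _ n X _ := X.hypBnd_hypRes n
  IsCycle := IsHypStr
  isCycle_res C n X _ := by
    rw [IsHypStr, BigCh.hypCastDim_hypRes, BigCh.hypBnd_hypRes]
  map := fHyp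
  map_res _ _ _ := rfl

end QTheory

/-- Let `f, f' : C → D` be chain maps of finite-dimensional `A`-module chain
complexes.  If `f` and `f'` are chain homotopic then for every `n` the induced maps on the
`Q`-groups coincide: `f^% = f'^% : Q^n(C) → Q^n(D)`, `f_% = f'_% : Q_n(C) → Q_n(D)` and
`f̂^% = f̂'^% : Q̂^n(C) → Q̂^n(D)`.  Moreover, if a chain map is a chain homotopy equivalence
then the induced maps are isomorphisms for every `n`. -/
theorem stmt4 (A : Type) [Ring A] [StarRing A] {C D : ChainCx A}
    (f f' : ChainMap C D) (hf : ChainHtpy f f') (n : ℤ) :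
    ((∃ Q, IsInducedSym f n Q) ∧ (∃ Q, IsInducedQuad f n Q) ∧ (∃ Q, IsInducedHyp f n Q)) ∧
    (∀ Q Q' : Qsym C n →+ Qsym D n,
      IsInducedSym f n Q → IsInducedSym f' n Q' → Q = Q') ∧
    (∀ Q Q' : Qquad C n →+ Qquad D n,
      IsInducedQuad f n Q → IsInducedQuad f' n Q' → Q = Q') ∧
    (∀ Q Q' : Qhyp C n →+ Qhyp D n,
      IsInducedHyp f n Q → IsInducedHyp f' n Q' → Q = Q') ∧
    (∀ e : ChainMap C D, IsChainEquiv e →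
      (∀ Q : Qsym C n →+ Qsym D n, IsInducedSym e n Q → Function.Bijective Q) ∧
      (∀ Q : Qquad C n →+ Qquad D n, IsInducedQuad e n Q → Function.Bijective Q) ∧
      (∀ Q : Qhyp C n →+ Qhyp D n, IsInducedHyp e n Q → Function.Bijective Q)) := by
  exact ⟨⟨(QTheory.sym A).exists_isInduced f n, (QTheory.quad A).exists_isInduced f n,
      (QTheory.hyp A).exists_isInduced f n⟩,
    fun _ _ hQ hQ' => QTheory.IsInduced.eq_of_chainHtpy (T := QTheory.sym A) hf hQ hQ',
    fun _ _ hQ hQ' => QTheory.IsInduced.eq_of_chainHtpy (T := QTheory.quad A) hf hQ hQ',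
    fun _ _ hQ hQ' => QTheory.IsInduced.eq_of_chainHtpy (T := QTheory.hyp A) hf hQ hQ',
    fun _ he => ⟨fun _ hQ => QTheory.IsInduced.bijective (T := QTheory.sym A) he hQ,
      fun _ hQ => QTheory.IsInduced.bijective (T := QTheory.quad A) he hQ,
      fun _ hQ => QTheory.IsInduced.bijective (T := QTheory.hyp A) he hQ⟩⟩
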